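/- arXiv:1807.08178 — 2 statements merged into one kernel-verified Lean document; each statement's English description precedes it below -/
import Mathlib

section
/- m̃_2(3) = 4: the minimum number of edges in a 3-uniform hypergraph that is not 2-DP-colorable equals 4. -/
open Finset

/-- The domain of a partial map `φ : X ⇀ Bool` (encoded as `X → Option Bool`). -/
def pdom {X : Type*} [Fintype X] (φ : X → Option Bool) : Finset X :=
  Finset.univ.filter (fun x => (φ x).isSome)

/-- A total function `f : X → Bool` extends the partial map `φ`. -/
def PExtends {X : Type*} (f : X → Bool) (φ : X → Option Bool) : Prop :=
  ∀ x b, φ x = some b → f x = b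

instance {X : Type*} [Fintype X] (f : X → Bool) : DecidablePred (PExtends f) :=
  fun φ => inferInstanceAs (Decidable (∀ x b, φ x = some b → f x = b))

/-- The weight of a family of partial maps: `∑ 2^{-|dom φ|}`. -/
noncomputable def weight {X : Type*} [Fintype X] (F : Finset (X → Option Bool)) : ℝ :=
  ∑ φ ∈ F, (1/2 : ℝ) ^ (pdom φ).card

/-- `F` is a 2-fold cover of the hypergraph `H`. -/
def IsCover {X : Type*} [Fintype X] (H : Finset (Finset X)) (F : Finset (X → Option Bool)) : Prop :=
  (∀ φ ∈ F, pdom φ ∈ H) ∧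
  (∀ φ ∈ F, ∀ ψ ∈ F, φ ≠ ψ → pdom φ = pdom ψ → ∀ x ∈ pdom φ, φ x ≠ ψ x)


def sgn (i j : Fin 4) : Bool := !![true, true, true, true; false, true, true, false;
  false, false, true, true; false, true, false, true] i j

def gmap (p : Fin 4 × Bool) : Fin 4 → Option Bool :=
  fun j => if p.1 = j then none else some (xor p.2 (sgn p.1 j))

theorem card_ext {m : ℕ} (φ : Fin m → Option Bool) (h : (pdom φ).card = 3) :
    8 * (univ.filter (fun f : Fin m → Bool => PExtends f φ)).card = 2 ^ m := by
  classical
  have h1 : univ.filter (fun f : Fin m → Bool => PExtends f φ)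
      = Fintype.piFinset (fun x => if (φ x).isSome then {(φ x).getD true} else univ) := by
    ext f
    rw [mem_filter, Fintype.mem_piFinset]
    simp only [mem_univ, true_and, PExtends]
    refine forall_congr' fun x => ?_
    cases φ x <;> simp
  rw [h1, Fintype.card_piFinset]
  have h2 : ∀ x, (if (φ x).isSome then {(φ x).getD true} else univ : Finset Bool).card
      = if (φ x).isSome then 1 else 2 := by
    intro x; split_ifs <;> simp
  simp only [h2]
  rw [Finset.prod_ite]
  simp only [prod_const, one_pow, one_mul]
  have h3 := Finset.card_filter_add_card_filter_not (s := (univ : Finset (Fin m)))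
    (fun x => (φ x).isSome = true)
  rw [card_univ, Fintype.card_fin] at h3
  unfold pdom at h
  rw [h] at h3
  have h4 : (2 : ℕ) ^ m = 2 ^ 3 * 2 ^ (univ.filter fun x => ¬(φ x).isSome = true).card := by
    rw [← pow_add, h3]
  rw [h4]
  norm_num

theorem card_cover {m : ℕ} (H : Finset (Finset (Fin m))) (F : Finset (Fin m → Option Bool))
    (hH : ∀ e ∈ H, e.card = 3) (hF : IsCover H F) : F.card ≤ 2 * H.card := by
  classical
  refine Finset.card_le_mul_card_image_of_maps_to (f := pdom) hF.1 2 ?_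
  intro e he
  by_contra hc
  push Not at hc
  obtain ⟨a, b, c, ha, hb, hc, hab, hac, hbc⟩ := Finset.two_lt_card_iff.1 hc
  simp only [mem_filter] at ha hb hc
  obtain ⟨x, hx⟩ : e.Nonempty := by
    rw [← Finset.card_pos, hH e he]; norm_num
  have xa : x ∈ pdom a := by rw [ha.2]; exact hx
  have xb : x ∈ pdom b := by rw [hb.2]; exact hx
  have xc : x ∈ pdom c := by rw [hc.2]; exact hx
  have h1 := hF.2 a ha.1 b hb.1 hab (ha.2.trans hb.2.symm) x xa
  have h2 := hF.2 a ha.1 c hc.1 hac (ha.2.trans hc.2.symm) x xa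
  have h3 := hF.2 b hb.1 c hc.1 hbc (hb.2.trans hc.2.symm) x xb
  simp only [pdom, mem_filter, mem_univ, true_and] at xa xb xc
  revert h1 h2 h3 xa xb xc
  generalize a x = p
  generalize b x = q
  generalize c x = r
  revert p q r
  decide

theorem stmt_10 :
    IsLeast {n : ℕ | ∃ (m : ℕ) (H : Finset (Finset (Fin m)))
      (F : Finset (Fin m → Option Bool)),
        (∀ e ∈ H, e.card = 3) ∧ IsCover H F ∧
        (∀ f : Fin m → Bool, ∃ φ ∈ F, PExtends f φ) ∧ H.card = n} 4 := by
  constructor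
  · refine ⟨4, univ.image (fun i : Fin 4 => univ.erase i), univ.image gmap, ?_, ⟨?_, ?_⟩, ?_, ?_⟩
    · decide
    · simp only [mem_image, mem_univ, true_and, forall_exists_index, forall_apply_eq_imp_iff]
      decide
    · simp only [mem_image, mem_univ, true_and, forall_exists_index, forall_apply_eq_imp_iff]
      decide
    · intro f
      have key : ∀ a b c d : Bool, ∃ p, PExtends ![a, b, c, d] (gmap p) := by
        unfold PExtends
        decide
      obtain ⟨p, hp⟩ := key (f 0) (f 1) (f 2) (f 3)
      refine ⟨gmap p, mem_image_of_mem _ (mem_univ _), ?_⟩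
      convert hp using 1
      ext i; fin_cases i <;> rfl
    · decide
  · rintro n ⟨m, H, F, hH, hF, hcov, rfl⟩
    classical
    have h1 := card_cover H F hH hF
    have h2 : (univ : Finset (Fin m → Bool)) ⊆
        F.biUnion (fun φ => univ.filter (fun f : Fin m → Bool => PExtends f φ)) := by
      intro f _
      obtain ⟨φ, h, h'⟩ := hcov f
      simp only [mem_biUnion, mem_filter, mem_univ, true_and]
      exact ⟨φ, h, h'⟩
    have h3 := (card_le_card h2).trans card_biUnion_le
    have h4 : 8 * ∑ φ ∈ F, (univ.filter (fun f : Fin m → Bool => PExtends f φ)).card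
        = F.card * 2 ^ m := by
      rw [mul_sum, sum_congr rfl (fun φ hφ => card_ext φ (hH _ (hF.1 φ hφ)))]
      simp
    simp only [card_univ, Fintype.card_fun, Fintype.card_bool, Fintype.card_fin] at h3
    have h5 : 8 * 2 ^ m ≤ F.card * 2 ^ m := by
      rw [← h4]; exact Nat.mul_le_mul_left 8 h3
    have h6 := Nat.le_of_mul_le_mul_right h5 (by positivity)
    omega
end

section
/- m̃_2(5) ≤ 17: there exists a 5-uniform hypergraph with 17 edges that is not 2-DP-colorable. -/
open Finset

/-- The 17 edges with their patterns: (bitmask of the domain, bitmask of the values). -/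
def dpEdges : List (ℕ × ℕ) :=
  [(118, 0), (124, 4), (87, 3), (188, 12), (122, 90), (157, 140), (185, 137), (91, 27), (173, 129), (213, 148), (107, 41), (109, 69), (103, 101), (241, 225), (93, 72), (55, 16), (59, 25)]

/-- The 34 partial maps: each pattern and its complement on the domain. -/
def dpMaps : List (ℕ × ℕ) :=
  dpEdges ++ dpEdges.map (fun a => (a.1, a.1 ^^^ a.2))

/-- The partial map coded by a pair of bitmasks. -/
def dpMk (a : ℕ × ℕ) : Fin 8 → Option Bool :=
  fun x => if a.1.testBit x then some (a.2.testBit x) else none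

/-- The edge coded by a bitmask. -/
def dpDom (d : ℕ) : Finset (Fin 8) := Finset.univ.filter (fun x => d.testBit x = true)

theorem pdom_dpMk (a : ℕ × ℕ) : pdom (dpMk a) = dpDom a.1 := by
  ext x
  by_cases h : a.1.testBit x = true <;> simp [pdom, dpDom, dpMk, h]

theorem dp_cover_nat : ∀ n < 256, ∃ a ∈ dpMaps, n &&& a.1 = a.2 := by decide +kernel

theorem dp_compat : ∀ a ∈ dpMaps, ∀ b ∈ dpMaps, a = b ∨
    (∃ x : Fin 8, a.1.testBit x ≠ b.1.testBit x) ∨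
    (∀ x : Fin 8, a.1.testBit x = true → a.2.testBit x ≠ b.2.testBit x) := by
  decide +kernel

theorem stmt_14 :
    ∃ (m : ℕ) (H : Finset (Finset (Fin m))) (F : Finset (Fin m → Option Bool)),
      (∀ e ∈ H, e.card = 5) ∧ H.card = 17 ∧ IsCover H F ∧
      (∀ f : Fin m → Bool, ∃ φ ∈ F, PExtends f φ) := by 
  classical
  refine ⟨8, (dpEdges.map (fun a => dpDom a.1)).toFinset, (dpMaps.map dpMk).toFinset,
    ?_, ?_, ⟨?_, ?_⟩, ?_⟩
  · intro e he
    simp only [List.mem_toFinset, List.mem_map] at he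
    obtain ⟨a, ha, rfl⟩ := he
    have h : ∀ a ∈ dpEdges, (dpDom a.1).card = 5 := by decide +kernel
    exact h a ha
  · have h : (dpEdges.map (fun a => dpDom a.1)).Nodup := by decide +kernel
    rw [List.toFinset_card_of_nodup h]
    rfl
  · intro φ hφ
    simp only [List.mem_toFinset, List.mem_map] at hφ ⊢
    obtain ⟨a, ha, rfl⟩ := hφ
    rw [pdom_dpMk]
    simp only [dpMaps, List.mem_append, List.mem_map] at ha
    rcases ha with ha | ⟨b, hb, rfl⟩
    · exact ⟨a, ha, rfl⟩
    · exact ⟨b, hb, rfl⟩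
  · intro φ hφ ψ hψ hne hdom x hx
    simp only [List.mem_toFinset, List.mem_map] at hφ hψ
    obtain ⟨a, ha, rfl⟩ := hφ
    obtain ⟨b, hb, rfl⟩ := hψ
    rw [pdom_dpMk, pdom_dpMk] at hdom
    rw [pdom_dpMk] at hx
    have key : ∀ y : Fin 8, a.1.testBit y = true ↔ b.1.testBit y = true := by
      intro y
      have := congrArg (fun s => y ∈ s) hdom
      simpa [dpDom] using this
    have hxa : a.1.testBit x = true := by simpa [dpDom] using hx
    have hxb := (key x).1 hxa
    rcases dp_compat a ha b hb with h | ⟨y, hy⟩ | h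
    · exact absurd (congrArg dpMk h) hne
    · exact absurd (Bool.eq_iff_iff.2 (key y)) hy
    · simpa [dpMk, hxa, hxb] using h x hxa
  · intro f
    obtain ⟨a, ha, hn⟩ := dp_cover_nat (Nat.ofBits f) (Nat.ofBits_lt_two_pow f)
    refine ⟨dpMk a, ?_, ?_⟩
    · simp only [List.mem_toFinset, List.mem_map]
      exact ⟨a, ha, rfl⟩
    · intro x b hb
      by_cases hd : a.1.testBit x = true
      · simp only [dpMk, hd, if_true, Option.some.injEq] at hb
        rw [← hb, ← hn, Nat.testBit_and, hd, Nat.testBit_ofBits_lt f x x.2]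
        simp
      · simp [dpMk, hd] at hb
end
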